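/- arXiv:0808.2692 — 4 statements merged into one kernel-verified Lean document; each statement's English description precedes it below -/
import Mathlib

section
/- ∫₀^∞ x ( e^{-x²/π} + 2 e^{-16x²/π} ) (sinh(2x)/cosh²(2x)) dx = ∫₀^∞ e^{-4x²/π}/cosh(4x) dx. -/
open Real MeasureTheory

open scoped FourierTransform

lemma sigmoid_two_mul (t : ℝ) : sigmoid (2 * t) = exp t / (2 * cosh t) := by
  have h : exp (-(2 * t)) = exp (-t) * exp (-t) := by rw [← exp_add]; ring_nf
  have h' : exp t * exp (-t) = 1 := by rw [← exp_add]; simp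
  have := exp_pos t
  have := exp_pos (-t)
  rw [sigmoid_def, cosh_eq, h, inv_eq_one_div, div_eq_div_iff (by positivity) (by positivity)]
  linear_combination -exp (-t) * h'

lemma sech_betaIntegrand (w t : ℝ) :
    |2 * π * (sigmoid (2 * t) * (1 - sigmoid (2 * t)))| •
      ((sigmoid (2 * t) : ℂ) ^ ((1 / 2 - w * Complex.I : ℂ) - 1) *
        (1 - (sigmoid (2 * t) : ℂ)) ^ ((1 / 2 + w * Complex.I : ℂ) - 1)) =
      π * (Complex.exp ((-2 * t * w : ℝ) * Complex.I) * ((1 / cosh t : ℝ) : ℂ)) := by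
  have hc : 0 < 2 * cosh t := by have := cosh_pos t; positivity
  have ha : 0 < sigmoid (2 * t) := sigmoid_pos _
  have hb : 0 < 1 - sigmoid (2 * t) := by rw [← sigmoid_neg]; exact sigmoid_pos _
  have hb' : 1 - sigmoid (2 * t) = exp (-t) / (2 * cosh t) := by
    rw [← sigmoid_neg, ← mul_neg, sigmoid_two_mul, cosh_neg]
  have hla : log (sigmoid (2 * t)) = t - log (2 * cosh t) := by
    rw [sigmoid_two_mul, log_div (exp_pos _).ne' hc.ne', log_exp]
  have hlb : log (1 - sigmoid (2 * t)) = -t - log (2 * cosh t) := by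
    rw [hb', log_div (exp_pos _).ne' hc.ne', log_exp]
  have hab : sigmoid (2 * t) * (1 - sigmoid (2 * t)) = 1 / (2 * cosh t) ^ 2 := by
    rw [hb', sigmoid_two_mul, div_mul_div_comm, ← exp_add]
    simp [sq]
  have hexp : Complex.exp ((log (2 * cosh t) : ℝ) : ℂ) = ((2 * cosh t : ℝ) : ℂ) := by
    rw [← Complex.ofReal_exp, exp_log hc]
  have h1 : (1 : ℂ) - (sigmoid (2 * t) : ℂ) = ((1 - sigmoid (2 * t) : ℝ) : ℂ) := by push_cast; rfl
  rw [h1, Complex.cpow_def_of_ne_zero (by exact_mod_cast ha.ne'),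
    Complex.cpow_def_of_ne_zero (by exact_mod_cast hb.ne'), ← Complex.ofReal_log ha.le,
    ← Complex.ofReal_log hb.le, hla, hlb, ← Complex.exp_add, abs_of_pos (by positivity), hab]
  have : ((t - log (2 * cosh t) : ℝ) : ℂ) * ((1 / 2 - w * Complex.I : ℂ) - 1) +
      ((-t - log (2 * cosh t) : ℝ) : ℂ) * ((1 / 2 + w * Complex.I : ℂ) - 1) =
      ((log (2 * cosh t) : ℝ) : ℂ) + (-2 * t * w : ℝ) * Complex.I := by
    push_cast; ring
  rw [this, Complex.exp_add, hexp, Complex.real_smul]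
  have hcc : (Complex.cosh t : ℂ) ≠ 0 := by
    rw [← Complex.ofReal_cosh]; exact_mod_cast (cosh_pos t).ne'
  push_cast
  field_simp

lemma fourier_sech (w : ℝ) :
    𝓕 (fun y : ℝ ↦ ((1 / cosh (π * y) : ℝ) : ℂ)) w = ((1 / cosh (π * w) : ℝ) : ℂ) := by
  have hB : Complex.betaIntegral (1 / 2 - w * Complex.I) (1 / 2 + w * Complex.I) =
      π * ((1 / cosh (π * w) : ℝ) : ℂ) := by
    have h := Complex.Gamma_mul_Gamma_eq_betaIntegral (s := 1 / 2 - w * Complex.I)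
      (t := 1 / 2 + w * Complex.I) (by simp) (by simp)
    have h1 : (1 / 2 - w * Complex.I : ℂ) + (1 / 2 + w * Complex.I) = 1 := by ring
    have h2 : (1 / 2 + w * Complex.I : ℂ) = 1 - (1 / 2 - w * Complex.I) := by ring
    rw [h1, Complex.Gamma_one, one_mul] at h
    rw [← h, h2, Complex.Gamma_mul_Gamma_one_sub]
    have h3 : (π * (1 / 2 - w * Complex.I) : ℂ) = π / 2 - (π * w : ℝ) * Complex.I := by
      push_cast; ring
    rw [h3, Complex.sin_pi_div_two_sub, Complex.cos_mul_I]
    push_cast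
    ring
  have himg : (fun y : ℝ ↦ sigmoid (2 * (π * y))) '' Set.univ = Set.Ioo 0 1 := by
    rw [Set.image_univ, ← range_sigmoid]
    refine Function.Surjective.range_comp (f := fun y : ℝ ↦ 2 * (π * y)) (fun z ↦ ?_) sigmoid
    exact ⟨z / (2 * π), by field_simp⟩
  have hder (y : ℝ) : HasDerivAt (fun y : ℝ ↦ sigmoid (2 * (π * y)))
      (2 * π * (sigmoid (2 * (π * y)) * (1 - sigmoid (2 * (π * y))))) y := by
    have := (hasDerivAt_sigmoid (2 * (π * y))).comp y
      (((hasDerivAt_id y).const_mul π).const_mul 2)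
    convert! this using 1
    ring
  have hinj : Set.InjOn (fun y : ℝ ↦ sigmoid (2 * (π * y))) Set.univ := by
    intro x _ y _ h
    have := sigmoid_injective h
    simpa [pi_ne_zero] using this
  rw [Complex.betaIntegral, intervalIntegral.integral_of_le zero_le_one,
    integral_Ioc_eq_integral_Ioo, ← himg,
    integral_image_eq_integral_abs_deriv_smul MeasurableSet.univ
      (fun y _ ↦ (hder y).hasDerivWithinAt) hinj] at hB
  simp_rw [sech_betaIntegrand, setIntegral_univ, integral_const_mul] at hB
  rw [Real.fourier_real_eq_integral_exp_smul,
    ← mul_left_cancel₀ (by exact_mod_cast pi_ne_zero : (π : ℂ) ≠ 0) hB]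
  refine integral_congr_ae (.of_forall fun y ↦ ?_)
  simp only [smul_eq_mul]
  congr 4
  ring

lemma integrable_sech : Integrable (fun y : ℝ ↦ ((1 / cosh (π * y) : ℝ) : ℂ)) := by
  by_contra h
  have h0 := fourier_sech 0
  rw [Real.fourier_real_eq_integral_exp_smul] at h0
  simp only [mul_zero, Complex.ofReal_zero, zero_mul, Complex.exp_zero, one_smul] at h0
  rw [integral_undef h] at h0
  simp at h0

lemma integrable_sq_mul_exp_neg_mul_sq {b : ℝ} (hb : 0 < b) :
    Integrable fun x : ℝ ↦ x ^ 2 * exp (-b * x ^ 2) := by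
  simpa using integrable_rpow_mul_exp_neg_mul_sq hb (by norm_num : (-1 : ℝ) < 2)

lemma hasDerivAt_exp_neg_mul_sq (b x : ℝ) :
    HasDerivAt (fun x : ℝ ↦ exp (-b * x ^ 2)) (-2 * b * (x * exp (-b * x ^ 2))) x := by
  convert! ((hasDerivAt_pow 2 x).const_mul (-b)).exp using 1
  simp
  ring

lemma hasDerivAt_mul_exp_neg_mul_sq (b x : ℝ) :
    HasDerivAt (fun x : ℝ ↦ x * exp (-b * x ^ 2)) ((1 - 2 * b * x ^ 2) * exp (-b * x ^ 2)) x := by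
  convert! (hasDerivAt_id x).mul (hasDerivAt_exp_neg_mul_sq b x) using 1
  simp
  ring

lemma integrable_deriv_mul_exp_neg_mul_sq {b : ℝ} (hb : 0 < b) :
    Integrable fun x : ℝ ↦ (1 - 2 * b * x ^ 2) * exp (-b * x ^ 2) := by
  refine ((integrable_exp_neg_mul_sq hb).sub
    ((integrable_sq_mul_exp_neg_mul_sq hb).const_mul (2 * b))).congr (.of_forall fun x ↦ ?_)
  simp only [Pi.sub_apply]
  ring

lemma fourier_exp_neg_four_pi_mul_sq (w : ℝ) :
    𝓕 (fun x : ℝ ↦ ((exp (-(4 * π) * x ^ 2) : ℝ) : ℂ)) w =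
      ((exp (-(π / 4) * w ^ 2) / 2 : ℝ) : ℂ) := by
  have h := congrFun (fourier_gaussian_pi (b := 4) (by norm_num)) w
  have h4 : (4 : ℂ) ^ (1 / 2 : ℂ) = 2 := by
    have h := Complex.ofReal_cpow (x := 4) (by norm_num) (1 / 2)
    rw [← sqrt_eq_rpow, show (4 : ℝ) = 2 ^ 2 by norm_num, sqrt_sq (by norm_num)] at h
    norm_num at h
    norm_num [← h]
  rw [h4] at h
  convert! h using 2
  · ext x
    push_cast
    ring_nf
  · push_cast
    ring_nf

lemma fourier_deriv_mul_exp_neg_four_pi_mul_sq (w : ℝ) :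
    𝓕 (fun x : ℝ ↦ (((1 - 2 * (4 * π) * x ^ 2) * exp (-(4 * π) * x ^ 2) : ℝ) : ℂ)) w =
      ((π / 4 * w ^ 2 * exp (-(π / 4) * w ^ 2) : ℝ) : ℂ) := by
  have hb : 0 < 4 * π := by positivity
  have hd₁ (x : ℝ) := (hasDerivAt_exp_neg_mul_sq (4 * π) x).ofReal_comp
  have hd₂ (x : ℝ) := (hasDerivAt_mul_exp_neg_mul_sq (4 * π) x).ofReal_comp
  have e₁ := funext fun x ↦ (hd₁ x).deriv
  have e₂ := funext fun x ↦ (hd₂ x).deriv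
  have h₁ := congrFun (Real.fourier_deriv (integrable_exp_neg_mul_sq hb).ofReal
    (fun x ↦ (hd₁ x).differentiableAt)
    (by rw [e₁]; exact ((integrable_mul_exp_neg_mul_sq hb).const_mul _).ofReal)) w
  have h₂ := congrFun (Real.fourier_deriv (integrable_mul_exp_neg_mul_sq hb).ofReal
    (fun x ↦ (hd₂ x).differentiableAt)
    (by rw [e₂]; exact (integrable_deriv_mul_exp_neg_mul_sq hb).ofReal)) w
  rw [e₂] at h₂
  rw [h₂]
  rw [e₁, fourier_exp_neg_four_pi_mul_sq] at h₁
  have h₃ : 𝓕 (fun x : ℝ ↦ ((-2 * (4 * π) * (x * exp (-(4 * π) * x ^ 2)) : ℝ) : ℂ)) w =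
      -2 * (4 * π) * 𝓕 (fun x : ℝ ↦ ((x * exp (-(4 * π) * x ^ 2) : ℝ) : ℂ)) w := by
    rw [Real.fourier_real_eq_integral_exp_smul, Real.fourier_real_eq_integral_exp_smul,
      ← integral_const_mul]
    congr 1 with x
    simp only [smul_eq_mul]
    push_cast
    ring
  rw [h₃] at h₁
  have hp : (π : ℂ) ≠ 0 := by exact_mod_cast pi_ne_zero
  have hp8 : (-2 * (4 * π) : ℂ) ≠ 0 := by simp [hp]
  apply mul_left_cancel₀ hp8
  simp only [smul_eq_mul] at h₁ ⊢
  rw [mul_left_comm, h₁]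
  push_cast
  linear_combination (2 * π ^ 2 * w ^ 2 * Complex.exp (-(π / 4) * w ^ 2)) * Complex.I_sq

lemma integral_deriv_mul_exp_neg_mul_sq_mul_sech :
    ∫ y : ℝ, ((1 - 2 * (4 * π) * y ^ 2) * exp (-(4 * π) * y ^ 2)) * (1 / cosh (π * y)) =
      ∫ y : ℝ, (π / 4 * y ^ 2 * exp (-(π / 4) * y ^ 2)) * (1 / cosh (π * y)) := by
  have h := VectorFourier.integral_fourierIntegral_smul_eq_flip (L := innerₗ ℝ)
    (μ := volume) (ν := volume)
    Real.continuous_fourierChar continuous_inner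
    (integrable_deriv_mul_exp_neg_mul_sq (b := 4 * π) (by positivity)).ofReal integrable_sech
  have h' : ∫ w : ℝ, 𝓕 (fun x : ℝ ↦
        (((1 - 2 * (4 * π) * x ^ 2) * exp (-(4 * π) * x ^ 2) : ℝ) : ℂ)) w *
        ((1 / cosh (π * w) : ℝ) : ℂ) =
      ∫ x : ℝ, (((1 - 2 * (4 * π) * x ^ 2) * exp (-(4 * π) * x ^ 2) : ℝ) : ℂ) *
        𝓕 (fun y : ℝ ↦ ((1 / cosh (π * y) : ℝ) : ℂ)) x := by
    simpa using! h
  simp_rw [fourier_sech, fourier_deriv_mul_exp_neg_four_pi_mul_sq, ← Complex.ofReal_mul] at h'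
  rw [integral_complex_ofReal, integral_complex_ofReal] at h'
  exact_mod_cast h'.symm

lemma MeasureTheory.Integrable.mul_sech {f : ℝ → ℝ} (hf : Integrable f) :
    Integrable fun y ↦ f y * (1 / cosh (π * y)) := by
  refine hf.mul_bdd (c := 1) ?_ (.of_forall fun y ↦ ?_)
  · exact (Continuous.div (by fun_prop) (by fun_prop)
      fun y ↦ (cosh_pos _).ne').aestronglyMeasurable
  · rw [norm_eq_abs, abs_of_pos (by have := cosh_pos (π * y); positivity)]
    exact div_le_one_of_le₀ (one_le_cosh _) (cosh_pos _).le

lemma MeasureTheory.Integrable.mul_sinh_div_cosh_sq {f : ℝ → ℝ} (hf : Integrable f) :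
    Integrable fun y ↦ f y * (sinh (π * y) / cosh (π * y) ^ 2) := by
  refine hf.mul_bdd (c := 1) ?_ (.of_forall fun y ↦ ?_)
  · exact (Continuous.div (by fun_prop) (by fun_prop)
      fun y ↦ pow_ne_zero 2 (cosh_pos _).ne').aestronglyMeasurable
  · have hc := one_le_cosh (π * y)
    rw [norm_eq_abs, abs_div, abs_of_nonneg (sq_nonneg (cosh (π * y)))]
    refine div_le_one_of_le₀ (abs_le_of_sq_le_sq ?_ (by positivity)) (by positivity)
    nlinarith [cosh_sq (π * y), sq_nonneg (cosh (π * y) ^ 2 - 1)]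

lemma hasDerivAt_sech (y : ℝ) :
    HasDerivAt (fun y : ℝ ↦ 1 / cosh (π * y)) (-π * (sinh (π * y) / cosh (π * y) ^ 2)) y := by
  have h := ((hasDerivAt_id y).const_mul π).cosh
  convert! (hasDerivAt_const y (1 : ℝ)).div h (cosh_pos _).ne' using 1
  simp
  ring

lemma integral_mul_exp_neg_mul_sq_mul_sinh_div_cosh_sq {b : ℝ} (hb : 0 < b) :
    π * ∫ y : ℝ, y * exp (-b * y ^ 2) * (sinh (π * y) / cosh (π * y) ^ 2) =
      ∫ y : ℝ, ((1 - 2 * b * y ^ 2) * exp (-b * y ^ 2)) * (1 / cosh (π * y)) := by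
  have i₁ := (integrable_deriv_mul_exp_neg_mul_sq hb).mul_sech
  have i₂ := (integrable_mul_exp_neg_mul_sq hb).mul_sinh_div_cosh_sq
  have h := integral_eq_zero_of_hasDerivAt_of_integrable
    (fun y ↦ (hasDerivAt_mul_exp_neg_mul_sq b y).mul (hasDerivAt_sech y))
    ((i₁.sub (i₂.const_mul π)).congr (.of_forall fun y ↦ by simp only [Pi.sub_apply]; ring))
    (integrable_mul_exp_neg_mul_sq hb).mul_sech
  rw [← integral_const_mul, ← sub_eq_zero, ← integral_sub (i₂.const_mul π) i₁, ← neg_eq_zero,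
    ← integral_neg, ← h]
  congr 1 with y
  ring

lemma integral_gaussian_sinh_div_cosh_sq :
    ∫ y : ℝ, (π / 2 * y) * (exp (-(π / 4) * y ^ 2) + 2 * exp (-(4 * π) * y ^ 2)) *
        (sinh (π * y) / cosh (π * y) ^ 2) =
      (∫ y : ℝ, exp (-(π / 4) * y ^ 2) * (1 / cosh (π * y))) / 2 := by
  have h₁ : 0 < π / 4 := by positivity
  have h₂ : 0 < 4 * π := by positivity
  have j₁ := (integrable_mul_exp_neg_mul_sq h₁).mul_sinh_div_cosh_sq
  have j₂ := (integrable_mul_exp_neg_mul_sq h₂).mul_sinh_div_cosh_sq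
  have k₁ := (integrable_exp_neg_mul_sq h₁).mul_sech
  have k₂ : Integrable fun y : ℝ ↦
      (π / 4 * y ^ 2 * exp (-(π / 4) * y ^ 2)) * (1 / cosh (π * y)) := by
    simpa only [mul_assoc] using
      ((integrable_sq_mul_exp_neg_mul_sq h₁).const_mul (π / 4)).mul_sech
  have e : ∫ y : ℝ, ((1 - 2 * (π / 4) * y ^ 2) * exp (-(π / 4) * y ^ 2)) * (1 / cosh (π * y)) =
      (∫ y : ℝ, exp (-(π / 4) * y ^ 2) * (1 / cosh (π * y))) -
        2 * ∫ y : ℝ, (π / 4 * y ^ 2 * exp (-(π / 4) * y ^ 2)) * (1 / cosh (π * y)) := by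
    rw [← integral_const_mul, ← integral_sub k₁ (k₂.const_mul 2)]
    congr 1 with y
    ring
  have s : ∫ y : ℝ, (π / 2 * y) * (exp (-(π / 4) * y ^ 2) + 2 * exp (-(4 * π) * y ^ 2)) *
        (sinh (π * y) / cosh (π * y) ^ 2) =
      π / 2 * (∫ y : ℝ, y * exp (-(π / 4) * y ^ 2) * (sinh (π * y) / cosh (π * y) ^ 2)) +
        π * ∫ y : ℝ, y * exp (-(4 * π) * y ^ 2) * (sinh (π * y) / cosh (π * y) ^ 2) := by
    rw [← integral_const_mul, ← integral_const_mul,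
      ← integral_add (j₁.const_mul _) (j₂.const_mul _)]
    congr 1 with y
    ring
  have f₁ := integral_mul_exp_neg_mul_sq_mul_sinh_div_cosh_sq h₁
  have f₂ := integral_mul_exp_neg_mul_sq_mul_sinh_div_cosh_sq h₂
  rw [s, f₂, integral_deriv_mul_exp_neg_mul_sq_mul_sech]
  linear_combination f₁ / 2 + e / 2

lemma integral_Ioi_eq_of_even {f : ℝ → ℝ} (hf : f.Even) {c : ℝ} (hc : 0 < c) :
    ∫ x in Set.Ioi 0, f x = c / 2 * ∫ y, f (c * y) := by
  have h : ∀ x, f |x| = f x := fun x ↦ by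
    rcases abs_choice x with h | h <;> rw [h]
    exact hf x
  have := integral_comp_abs (f := f)
  simp_rw [h] at this
  rw [Measure.integral_comp_mul_left, this, abs_of_pos (inv_pos.2 hc), smul_eq_mul]
  field_simp

theorem russell_integral_2 :
    ∫ x in Set.Ioi (0:ℝ),
      x * (Real.exp (-x^2 / π) + 2 * Real.exp (-16 * x^2 / π)) *
        (Real.sinh (2 * x) / (Real.cosh (2 * x))^2) =
    ∫ x in Set.Ioi (0:ℝ), Real.exp (-4 * x^2 / π) / Real.cosh (4 * x) := by
  rw [integral_Ioi_eq_of_even (c := π / 2) (fun x ↦ by simp [sinh_neg, cosh_neg]; ring)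
      (by positivity),
    integral_Ioi_eq_of_even (c := π / 4) (fun x ↦ by simp [cosh_neg]) (by positivity)]
  have h := integral_gaussian_sinh_div_cosh_sq
  have e₁ (y : ℝ) : -(π / 2 * y) ^ 2 / π = -(π / 4) * y ^ 2 := by field_simp; ring
  have e₂ (y : ℝ) : -16 * (π / 2 * y) ^ 2 / π = -(4 * π) * y ^ 2 := by field_simp; ring
  have e₃ (y : ℝ) : -4 * (π / 4 * y) ^ 2 / π = -(π / 4) * y ^ 2 := by field_simp
  have e₄ (y : ℝ) : 2 * (π / 2 * y) = π * y := by ring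
  have e₅ (y : ℝ) : 4 * (π / 4 * y) = π * y := by ring
  simp_rw [e₁, e₂, e₃, e₄, e₅, h, div_eq_mul_one_div (exp _)]
  ring
end

section
/- ∫₀^∞ ( sinh(x)/cosh²(x) + π^{3/2} sinh(πx)/cosh²(πx) ) x e^{-x²} dx = ∫₀^∞ e^{-x²}/cosh(x) dx. -/
open Real MeasureTheory
open scoped FourierTransform

lemma image_sigmoid_mul {c : ℝ} (hc : c ≠ 0) :
    (fun t : ℝ => sigmoid (c * t)) '' Set.univ = Set.Ioo 0 1 := by
  rw [Set.image_univ, ← range_sigmoid]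
  exact (mul_left_surjective₀ hc).range_comp sigmoid

lemma hasDerivAt_sigmoid_mul (c t : ℝ) :
    HasDerivAt (fun t : ℝ => sigmoid (c * t))
      (c * (sigmoid (c * t) * (1 - sigmoid (c * t)))) t := by
  have h := (hasDerivAt_sigmoid (c * t)).comp t ((hasDerivAt_id t).const_mul c)
  simpa [Function.comp_def, mul_comm] using h

lemma beta_integrand_sigmoid (y t : ℝ) :
    |2 * π * (sigmoid (2 * π * t) * (1 - sigmoid (2 * π * t)))| •
      (((sigmoid (2 * π * t) : ℝ) : ℂ) ^ ((1 / 2 - y * Complex.I) - 1) *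
        (1 - ((sigmoid (2 * π * t) : ℝ) : ℂ)) ^ ((1 / 2 + y * Complex.I) - 1)) =
      π * (Complex.exp (↑(-2 * π * t * y) * Complex.I) • ((1 / cosh (π * t) : ℝ) : ℂ)) := by
  set X := sigmoid (2 * π * t) with hX
  set Y := 1 - X with hY
  have hX0 : 0 < X := sigmoid_pos _
  have hY0 : 0 < Y := sub_pos.2 (sigmoid_lt_one _)
  have hYd : Y = (1 + exp (2 * π * t))⁻¹ := by
    rw [hY, hX, ← sigmoid_neg, sigmoid_def, neg_neg]
  have hXY : X = Y * exp (2 * π * t) := by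
    have := sigmoid_mul_rexp_neg (-(2 * π * t))
    rw [sigmoid_neg, neg_neg] at this
    exact this.symm
  have hlog : log X = log Y + 2 * π * t := by
    rw [hXY, log_mul hY0.ne' (exp_ne_zero _), log_exp]
  have hcast : (1 - (X : ℂ)) = (Y : ℂ) := by rw [hY]; push_cast; rfl
  have hcosh : Y * exp (π * t) = 1 / (2 * cosh (π * t)) := by
    rw [hYd, cosh_eq, show 2 * π * t = π * t + π * t by ring, Real.exp_add, Real.exp_neg]
    field_simp
    ring
  have hXc : (X : ℂ) ≠ 0 := by exact_mod_cast hX0.ne'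
  have hYc : (Y : ℂ) ≠ 0 := by exact_mod_cast hY0.ne'
  rw [abs_of_nonneg (by positivity), hcast, Complex.real_smul]
  push_cast
  have key : (X : ℂ) * Y * ((X : ℂ) ^ ((1 / 2 - y * Complex.I) - 1) *
      (Y : ℂ) ^ ((1 / 2 + y * Complex.I) - 1)) =
      ((Y * exp (π * t) : ℝ) : ℂ) * Complex.exp (↑(-2 * π * t * y) * Complex.I) := by
    rw [Complex.cpow_sub _ _ hXc, Complex.cpow_sub _ _ hYc, Complex.cpow_one, Complex.cpow_one]
    have : ((Y * exp (π * t) : ℝ) : ℂ) * Complex.exp (↑(-2 * π * t * y) * Complex.I) =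
        (X : ℂ) ^ (1 / 2 - y * Complex.I) * (Y : ℂ) ^ (1 / 2 + y * Complex.I) := by
      rw [Complex.cpow_def_of_ne_zero hXc, Complex.cpow_def_of_ne_zero hYc,
        ← Complex.ofReal_log hX0.le, ← Complex.ofReal_log hY0.le, hlog]
      nth_rewrite 1 [← exp_log hY0]
      rw [← Real.exp_add, Complex.ofReal_exp, ← Complex.exp_add, ← Complex.exp_add]
      congr 1
      push_cast
      ring
    rw [this]
    field_simp
  rw [hcosh] at key
  push_cast at key
  rw [smul_eq_mul]
  linear_combination (2 * π : ℂ) * key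

lemma integrable_exp_mul_sech_pi (y : ℝ) :
    Integrable (fun t : ℝ =>
      Complex.exp (↑(-2 * π * t * y) * Complex.I) • ((1 / cosh (π * t) : ℝ) : ℂ)) := by
  have h := Complex.betaIntegral_convergent (u := 1 / 2 - y * Complex.I)
    (v := 1 / 2 + y * Complex.I) (by simp) (by simp)
  rw [intervalIntegrable_iff_integrableOn_Ioo_of_le zero_le_one,
    ← image_sigmoid_mul two_pi_pos.ne',
    integrableOn_image_iff_integrableOn_abs_deriv_smul MeasurableSet.univ
      (fun t _ => (hasDerivAt_sigmoid_mul (2 * π) t).hasDerivWithinAt)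
      (sigmoid_injective.comp (mul_right_injective₀ two_pi_pos.ne')).injOn,
    integrableOn_univ] at h
  simp_rw [beta_integrand_sigmoid] at h
  exact (integrable_const_mul_iff (by simp [pi_ne_zero]) _).1 h

lemma integrable_sech_pi : Integrable (fun t : ℝ => ((1 / cosh (π * t) : ℝ) : ℂ)) := by
  simpa using integrable_exp_mul_sech_pi 0

/-- The function `sech (π t)` is its own Fourier transform. -/
lemma fourier_sech_pi (y : ℝ) :
    𝓕 (fun t : ℝ => ((1 / cosh (π * t) : ℝ) : ℂ)) y = ((1 / cosh (π * y) : ℝ) : ℂ) := by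
  rw [fourier_real_eq_integral_exp_smul]
  have h : Complex.betaIntegral (1 / 2 - y * Complex.I) (1 / 2 + y * Complex.I) =
      π * ∫ t : ℝ, Complex.exp (↑(-2 * π * t * y) * Complex.I) • ((1 / cosh (π * t) : ℝ) : ℂ) := by
    rw [Complex.betaIntegral, intervalIntegral.integral_of_le zero_le_one,
      integral_Ioc_eq_integral_Ioo, ← image_sigmoid_mul two_pi_pos.ne',
      integral_image_eq_integral_abs_deriv_smul MeasurableSet.univ
        (fun t _ => (hasDerivAt_sigmoid_mul (2 * π) t).hasDerivWithinAt)
        (sigmoid_injective.comp (mul_right_injective₀ two_pi_pos.ne')).injOn,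
      Measure.restrict_univ]
    simp_rw [beta_integrand_sigmoid]
    rw [integral_const_mul]
  rw [Complex.betaIntegral_eq_Gamma_mul_div _ _ (by simp) (by simp),
    show (1 / 2 + y * Complex.I : ℂ) = 1 - (1 / 2 - y * Complex.I) by ring,
    Complex.Gamma_mul_Gamma_one_sub, add_sub_cancel, Complex.Gamma_one, div_one,
    show (π * (1 / 2 - y * Complex.I) : ℂ) = π / 2 - (π * y) * Complex.I by ring,
    Complex.sin_pi_div_two_sub, Complex.cos_mul_I] at h
  have hpi : (π : ℂ) ≠ 0 := by simp [pi_ne_zero]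
  apply mul_left_cancel₀ hpi
  rw [← h]
  push_cast
  ring

lemma hasDerivAt_gaussian (x : ℝ) :
    HasDerivAt (fun x : ℝ => exp (-x ^ 2)) (-2 * (x * exp (-x ^ 2))) x := by
  have h := (hasDerivAt_pow 2 x).fun_neg.exp
  convert! h using 1
  push_cast
  ring

lemma hasDerivAt_mul_gaussian (x : ℝ) :
    HasDerivAt (fun x : ℝ => x * exp (-x ^ 2)) ((1 - 2 * x ^ 2) * exp (-x ^ 2)) x := by
  have h := (hasDerivAt_id' x).fun_mul (hasDerivAt_gaussian x)
  convert! h using 1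
  ring

lemma integrable_gaussian : Integrable (fun x : ℝ => exp (-x ^ 2)) := by
  simpa using integrable_exp_neg_mul_sq one_pos

lemma integrable_mul_gaussian : Integrable (fun x : ℝ => x * exp (-x ^ 2)) := by
  simpa using integrable_mul_exp_neg_mul_sq one_pos

lemma integrable_sq_mul_gaussian : Integrable (fun x : ℝ => x ^ 2 * exp (-x ^ 2)) := by
  simpa using integrable_rpow_mul_exp_neg_mul_sq one_pos (s := 2) (by norm_num)

lemma integrable_deriv_mul_gaussian :
    Integrable (fun x : ℝ => (1 - 2 * x ^ 2) * exp (-x ^ 2)) := by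
  convert integrable_gaussian.sub (integrable_sq_mul_gaussian.const_mul 2) using 1
  ext x; simp; ring

lemma fourier_gaussian (y : ℝ) :
    𝓕 (fun x : ℝ => ((exp (-x ^ 2) : ℝ) : ℂ)) y = ((√π * exp (-(π * y) ^ 2) : ℝ) : ℂ) := by
  have h := congrFun (fourier_gaussian_pi (b := ((π⁻¹ : ℝ) : ℂ))
    (by rw [Complex.ofReal_re]; positivity)) y
  have hpi : (π : ℂ) ≠ 0 := by simp [pi_ne_zero]
  have h1 : (fun x : ℝ => ((exp (-x ^ 2) : ℝ) : ℂ)) =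
      fun x : ℝ => Complex.exp (-π * ((π⁻¹ : ℝ) : ℂ) * x ^ 2) := by
    ext x
    push_cast
    field_simp
  have h2 : (((π⁻¹ : ℝ) : ℂ)) ^ (1 / 2 : ℂ) = ((√π)⁻¹ : ℝ) := by
    rw [show (1 / 2 : ℂ) = ((1 / 2 : ℝ) : ℂ) by push_cast; rfl,
      ← Complex.ofReal_cpow (by positivity), ← sqrt_eq_rpow, sqrt_inv]
  rw [h1, h, h2]
  push_cast
  rw [one_div, inv_inv]
  congr 2
  field_simp

lemma fourier_deriv_mul_gaussian (y : ℝ) :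
    𝓕 (fun x : ℝ => (((1 - 2 * x ^ 2) * exp (-x ^ 2) : ℝ) : ℂ)) y =
      ((2 * √π * ((π * y) ^ 2 * exp (-(π * y) ^ 2)) : ℝ) : ℂ) := by
  have d1 : deriv (fun x : ℝ => ((exp (-x ^ 2) : ℝ) : ℂ)) =
      fun x : ℝ => ((-2 : ℝ) : ℂ) • ((x * exp (-x ^ 2) : ℝ) : ℂ) := by
    ext x
    rw [(hasDerivAt_gaussian x).ofReal_comp.deriv]
    simp
  have d2 : deriv (fun x : ℝ => ((x * exp (-x ^ 2) : ℝ) : ℂ)) =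
      fun x : ℝ => (((1 - 2 * x ^ 2) * exp (-x ^ 2) : ℝ) : ℂ) :=
    funext fun x => (hasDerivAt_mul_gaussian x).ofReal_comp.deriv
  have f1 := congrFun (fourier_deriv (f := fun x : ℝ => ((exp (-x ^ 2) : ℝ) : ℂ))
    integrable_gaussian.ofReal
    (fun x => (hasDerivAt_gaussian x).ofReal_comp.differentiableAt)
    (by rw [d1]; exact Integrable.smul (𝕜 := ℂ) (β := ℂ) _ integrable_mul_gaussian.ofReal)) y
  have f2 := congrFun (fourier_deriv (f := fun x : ℝ => ((x * exp (-x ^ 2) : ℝ) : ℂ))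
    integrable_mul_gaussian.ofReal
    (fun x => (hasDerivAt_mul_gaussian x).ofReal_comp.differentiableAt)
    (by rw [d2]; exact integrable_deriv_mul_gaussian.ofReal)) y
  have hs : 𝓕 (fun x : ℝ => ((-2 : ℝ) : ℂ) • ((x * exp (-x ^ 2) : ℝ) : ℂ)) y =
      ((-2 : ℝ) : ℂ) • 𝓕 (fun x : ℝ => ((x * exp (-x ^ 2) : ℝ) : ℂ)) y := by
    simp_rw [fourier_real_eq_integral_exp_smul, smul_comm _ ((-2 : ℝ) : ℂ)]
    rw [integral_smul]
  rw [d1, hs, fourier_gaussian] at f1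
  rw [d2] at f2
  rw [f2]
  simp only [smul_eq_mul] at f1 ⊢
  push_cast at f1 ⊢
  linear_combination (-(1 / 2 : ℂ)) * (2 * π * Complex.I * y) * f1 -
    (2 * √π * (π * y) ^ 2 * Complex.exp (-(π * y) ^ 2) : ℂ) * Complex.I_sq

lemma integral_sech_mul_deriv_mul_gaussian :
    √π * ∫ x : ℝ, 1 / cosh (π * x) * ((1 - 2 * x ^ 2) * exp (-x ^ 2)) =
      2 * ∫ x : ℝ, 1 / cosh x * (x ^ 2 * exp (-x ^ 2)) := by
  have hg : Integrable (fun x : ℝ => (((1 - 2 * x ^ 2) * exp (-x ^ 2) : ℝ) : ℂ)) :=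
    integrable_deriv_mul_gaussian.ofReal
  have h := VectorFourier.integral_fourierIntegral_smul_eq_flip (L := innerₗ ℝ)
    (μ := volume) (ν := volume) Real.continuous_fourierChar continuous_inner integrable_sech_pi
    hg
  rw [flip_innerₗ] at h
  change ∫ y : ℝ, 𝓕 (fun t : ℝ => ((1 / cosh (π * t) : ℝ) : ℂ)) y • _ =
    ∫ x : ℝ, _ • 𝓕 (fun x : ℝ => (((1 - 2 * x ^ 2) * exp (-x ^ 2) : ℝ) : ℂ)) x at h
  simp_rw [fourier_sech_pi, fourier_deriv_mul_gaussian, smul_eq_mul, ← Complex.ofReal_mul] at h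
  rw [integral_complex_ofReal, integral_complex_ofReal, Complex.ofReal_inj] at h
  have hsub := Measure.integral_comp_mul_left
    (fun x : ℝ => 1 / cosh x * (2 * √π * (x ^ 2 * exp (-x ^ 2)))) π
  rw [h, hsub, abs_of_pos (by positivity), smul_eq_mul]
  simp_rw [mul_left_comm _ (2 * √π)]
  rw [integral_const_mul]
  have := mul_self_sqrt pi_pos.le
  field_simp
  rw [sq, this]

lemma hasDerivAt_one_div_cosh_mul (c x : ℝ) :
    HasDerivAt (fun x : ℝ => 1 / cosh (c * x)) (-(c * sinh (c * x) / cosh (c * x) ^ 2)) x := by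
  have h := ((hasDerivAt_id' x).const_mul c).cosh.fun_inv (cosh_pos _).ne'
  simp only [one_div]
  convert! h using 1
  ring

lemma abs_sinh_div_cosh_sq_le (x : ℝ) : |sinh x / cosh x ^ 2| ≤ 1 := by
  have h := one_le_cosh x
  rw [abs_div, abs_of_pos (pow_pos (cosh_pos x) 2), div_le_one (by positivity)]
  have h1 := sinh_lt_cosh x
  have h2 := sinh_lt_cosh (-x)
  rw [sinh_neg, cosh_neg] at h2
  exact abs_le.2 ⟨by nlinarith, by nlinarith⟩

lemma MeasureTheory.Integrable.one_div_cosh_mul {f : ℝ → ℝ} (hf : Integrable f) (c : ℝ) :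
    Integrable (fun x => 1 / cosh (c * x) * f x) := by
  refine hf.bdd_mul (c := 1) (Continuous.aestronglyMeasurable ?_) (.of_forall fun x => ?_)
  · exact continuous_const.div (by fun_prop) fun x => (cosh_pos _).ne'
  · rw [norm_eq_abs, abs_of_pos (by positivity), div_le_one (cosh_pos _)]
    exact one_le_cosh _

lemma MeasureTheory.Integrable.sinh_div_cosh_sq_mul {f : ℝ → ℝ} (hf : Integrable f) (c : ℝ) :
    Integrable (fun x => sinh (c * x) / cosh (c * x) ^ 2 * f x) := by
  refine hf.bdd_mul (c := 1) (Continuous.aestronglyMeasurable ?_)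
    (.of_forall fun x => abs_sinh_div_cosh_sq_le _)
  exact Continuous.div (by fun_prop) (by fun_prop) fun x => (pow_pos (cosh_pos _) 2).ne'

lemma integral_sinh_div_cosh_sq_mul_gaussian (c : ℝ) :
    c * ∫ x : ℝ, sinh (c * x) / cosh (c * x) ^ 2 * (x * exp (-x ^ 2)) =
      ∫ x : ℝ, 1 / cosh (c * x) * ((1 - 2 * x ^ 2) * exp (-x ^ 2)) := by
  have h := integral_mul_deriv_eq_deriv_mul_of_integrable
    (u := fun x : ℝ => 1 / cosh (c * x)) (v := fun x : ℝ => x * exp (-x ^ 2))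
    (fun x _ => hasDerivAt_one_div_cosh_mul c x) (fun x _ => hasDerivAt_mul_gaussian x)
    (integrable_deriv_mul_gaussian.one_div_cosh_mul c)
    (by
      convert (integrable_mul_gaussian.sinh_div_cosh_sq_mul c).const_mul (-c) using 1
      ext x
      simp only [Pi.mul_apply]
      ring)
    (integrable_mul_gaussian.one_div_cosh_mul c)
  rw [h, ← integral_const_mul, ← integral_neg]
  congr 1
  ext x
  ring

lemma integral_eq_two_mul_integral_Ioi_of_even {f : ℝ → ℝ} (hf : ∀ x, f (-x) = f x) :
    ∫ x, f x = 2 * ∫ x in Set.Ioi (0 : ℝ), f x := by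
  rw [← integral_comp_abs]
  congr 1
  ext x
  rcases abs_choice x with h | h <;> simp [h, hf]

theorem russell_integral_3 :
    ∫ x in Set.Ioi (0:ℝ),
      (Real.sinh x / (Real.cosh x)^2 +
        π ^ ((3:ℝ)/2) * Real.sinh (π * x) / (Real.cosh (π * x))^2) * (x * Real.exp (-x^2)) =
    ∫ x in Set.Ioi (0:ℝ), Real.exp (-x^2) / Real.cosh x := by
  apply mul_left_cancel₀ (two_ne_zero (α := ℝ))
  rw [← integral_eq_two_mul_integral_Ioi_of_even (fun x => by simp [neg_div]; ring),
    ← integral_eq_two_mul_integral_Ioi_of_even (fun x => by simp)]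
  have hpow : π ^ ((3:ℝ)/2) = √π * π := by
    rw [sqrt_eq_rpow, ← rpow_add_one pi_ne_zero]; norm_num
  have i1 := integrable_mul_gaussian.sinh_div_cosh_sq_mul 1
  have i2 := (integrable_mul_gaussian.sinh_div_cosh_sq_mul π).const_mul (√π * π)
  have j1 := integrable_deriv_mul_gaussian.one_div_cosh_mul 1
  have j2 := (integrable_sq_mul_gaussian.one_div_cosh_mul 1).const_mul 2
  have e1 := integral_sinh_div_cosh_sq_mul_gaussian 1
  have e2 := integral_sinh_div_cosh_sq_mul_gaussian π
  simp only [one_mul] at i1 j1 j2 e1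
  calc
    _ = ∫ x : ℝ, (sinh x / cosh x ^ 2 * (x * exp (-x ^ 2)) +
        √π * π * (sinh (π * x) / cosh (π * x) ^ 2 * (x * exp (-x ^ 2)))) := by
      rw [hpow]; congr 1; ext x; ring
    _ = (∫ x : ℝ, 1 / cosh x * ((1 - 2 * x ^ 2) * exp (-x ^ 2))) +
        ∫ x : ℝ, 2 * (1 / cosh x * (x ^ 2 * exp (-x ^ 2))) := by
      rw [integral_add i1 i2, integral_const_mul, integral_const_mul, e1, mul_assoc, e2,
        integral_sech_mul_deriv_mul_gaussian]
    _ = _ := by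
      rw [← integral_add j1 j2]; congr 1; ext x; ring
end

section
/- ∫₀^∞ x e^{-x²/π} (sinh(x)/cosh²(x)) dx = ∫₀^∞ e^{-4x²/π}/cosh(2x) dx. -/
open Real MeasureTheory
open scoped FourierTransform

lemma log_sigmoid (y : ℝ) :
    Real.log (sigmoid y) = y / 2 - Real.log (2 * Real.cosh (y / 2)) := by
  have hc : (0 : ℝ) < 2 * Real.cosh (y / 2) := by positivity
  have h : sigmoid y = Real.exp (y / 2) / (2 * Real.cosh (y / 2)) := by
    rw [sigmoid_def, inv_eq_one_div, div_eq_div_iff (by positivity) hc.ne', Real.cosh_eq,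
      mul_add, mul_one, ← Real.exp_add]
    ring_nf
  rw [h, Real.log_div (Real.exp_ne_zero _) hc.ne', Real.log_exp]

lemma fourier_one_div_cosh_pi_mul :
    𝓕 (fun x : ℝ ↦ ((1 / Real.cosh (π * x) : ℝ) : ℂ)) =
      fun x : ℝ ↦ ((1 / Real.cosh (π * x) : ℝ) : ℂ) := by
  ext w
  set u : ℂ := 1 / 2 - Complex.I * w with hu
  have hbeta : Complex.betaIntegral u (1 - u) = π / Complex.cosh (π * w) := by
    have h := Complex.Gamma_mul_Gamma_eq_betaIntegral (s := u) (t := 1 - u)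
      (by simp [hu]) (by simp [hu]; norm_num)
    rw [add_sub_cancel, Complex.Gamma_one, one_mul, Complex.Gamma_mul_Gamma_one_sub] at h
    rw [← h, hu, mul_sub, mul_one_div, Complex.sin_pi_div_two_sub,
      show (π : ℂ) * (Complex.I * w) = (π * w) * Complex.I by ring, Complex.cos_mul_I]
  have hsub : Complex.betaIntegral u (1 - u) =
      π * 𝓕 (fun x : ℝ ↦ ((1 / Real.cosh (π * x) : ℝ) : ℂ)) w := by
    have hrange : (fun v : ℝ ↦ sigmoid (2 * π * v)) '' Set.univ = Set.Ioo 0 1 := by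
      rw [Set.image_univ, ← range_sigmoid]
      exact (mul_left_surjective₀ (by positivity : (2 * π) ≠ 0)).range_comp sigmoid
    have hderiv (v : ℝ) : HasDerivAt (fun v : ℝ ↦ sigmoid (2 * π * v))
        (sigmoid (2 * π * v) * (1 - sigmoid (2 * π * v)) * (2 * π)) v :=
      (hasDerivAt_sigmoid (2 * π * v)).comp v (by simpa using (hasDerivAt_id v).const_mul (2 * π))
    have hinj : Set.InjOn (fun v : ℝ ↦ sigmoid (2 * π * v)) Set.univ :=
      (sigmoid_injective.comp (mul_right_injective₀ (by positivity))).injOn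
    rw [Complex.betaIntegral, intervalIntegral.integral_of_le zero_le_one,
      integral_Ioc_eq_integral_Ioo, ← hrange,
      integral_image_eq_integral_abs_deriv_smul MeasurableSet.univ
        (fun v _ ↦ (hderiv v).hasDerivWithinAt) hinj, setIntegral_univ,
      Real.fourier_real_eq_integral_exp_smul, ← integral_const_mul]
    congr with v
    have h1 := sigmoid_pos (2 * π * v)
    have h2 : 0 < 1 - sigmoid (2 * π * v) := sub_pos.2 (sigmoid_lt_one _)
    have l1 := log_sigmoid (2 * π * v)
    have l2 := log_sigmoid (-(2 * π * v))
    rw [sigmoid_neg, neg_div, Real.cosh_neg] at l2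
    rw [abs_of_pos (by positivity)]
    set x := sigmoid (2 * π * v)
    have e : 2 * π * v / 2 = π * v := by ring
    rw [e] at l1 l2
    have hc : (0 : ℝ) < 2 * Real.cosh (π * v) := by positivity
    have key (z : ℂ) (y : ℝ) (hy : 0 < y) : (y : ℂ) * (y : ℂ) ^ (z - 1) =
        Complex.exp (Real.log y * z) := by
      have : (y : ℂ) ≠ 0 := by exact_mod_cast hy.ne'
      rw [Complex.cpow_sub _ _ this, Complex.cpow_one, mul_div_cancel₀ _ this,
        Complex.cpow_def_of_ne_zero this, Complex.ofReal_log hy.le]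
    have k1 := key u x h1
    have k2 := key (1 - u) (1 - x) h2
    have hexp : Complex.exp (Real.log x * u) * Complex.exp (Real.log (1 - x) * (1 - u)) =
        Complex.exp (↑(-2 * π * v * w) * Complex.I) / (2 * Real.cosh (π * v) : ℝ) := by
      rw [← Real.exp_log hc, Complex.ofReal_exp, ← Complex.exp_sub, ← Complex.exp_add, l1, l2, hu]
      congr 1
      push_cast
      ring
    have hC : (Real.cosh (π * v) : ℂ) ≠ 0 := by
      exact_mod_cast (Real.cosh_pos _).ne'
    rw [← k1, ← k2] at hexp
    rw [Complex.real_smul, smul_eq_mul]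
    push_cast at hexp hC ⊢
    have hcancel (E : ℂ) : 2 * (π : ℂ) * (E / (2 * Complex.cosh (π * v))) =
        π * (E * (1 / Complex.cosh (π * v))) := by field_simp
    linear_combination (2 * π) * hexp + hcancel (Complex.exp (-2 * π * v * w * Complex.I))
  have hpi : (π : ℂ) ≠ 0 := by exact_mod_cast pi_ne_zero
  apply mul_left_cancel₀ hpi
  rw [← hsub, hbeta]
  push_cast
  ring

lemma integrable_one_div_cosh_pi_mul :
    Integrable (fun x : ℝ ↦ ((1 / Real.cosh (π * x) : ℝ) : ℂ)) := by
  have h := congrFun fourier_one_div_cosh_pi_mul 0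
  rw [Real.fourier_real_eq_integral_exp_smul] at h
  by_contra hn
  rw [integral_undef (by simpa using hn)] at h
  simp at h

lemma integrable_pow_mul_gaussian (n : ℕ) :
    Integrable (fun x : ℝ ↦ x ^ n * Real.exp (-π * x ^ 2)) := by
  simpa using integrable_rpow_mul_exp_neg_mul_sq pi_pos (s := n)
    (by linarith [n.cast_nonneg (α := ℝ)])

lemma fourier_sq_mul_gaussian :
    𝓕 (fun x : ℝ ↦ ((x ^ 2 * Real.exp (-π * x ^ 2) : ℝ) : ℂ)) =
      fun x : ℝ ↦ (((1 / (2 * π) - x ^ 2) * Real.exp (-π * x ^ 2) : ℝ) : ℂ) := by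
  set g : ℝ → ℂ := fun x ↦ Complex.exp (-π * x ^ 2) with hg
  have hgF : 𝓕 g = g := by
    simpa [hg] using fourier_gaussian_pi (b := 1) (by simp)
  have hint (n : ℕ) : Integrable (fun x : ℝ ↦ x ^ n • g x) := by
    have := (integrable_pow_mul_gaussian n).ofReal (𝕜 := ℂ)
    refine this.congr (.of_forall fun x ↦ ?_)
    simp [hg]
  have h := Real.iteratedDeriv_fourier (f := g) (N := ⊤) (n := 2) (fun n _ ↦ hint n) le_top
  have hd (x : ℝ) : HasDerivAt g (-2 * π * x * g x) x := by
    have := (((Complex.ofRealCLM.hasDerivAt (x := x)).pow 2).const_mul (-π : ℂ)).cexp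
    refine this.congr_deriv ?_
    simp [hg]; ring
  have hd2 (x : ℝ) : HasDerivAt (fun x : ℝ ↦ -2 * π * x * g x)
      ((4 * π ^ 2 * x ^ 2 - 2 * π) * g x) x := by
    have := ((Complex.ofRealCLM.hasDerivAt (x := x)).const_mul (-2 * π : ℂ)).mul (hd x)
    refine this.congr_deriv ?_
    simp; ring
  have hdd : iteratedDeriv 2 g = fun x : ℝ ↦ (4 * π ^ 2 * x ^ 2 - 2 * π) * g x := by
    rw [iteratedDeriv_succ, iteratedDeriv_one, funext fun x ↦ (hd x).deriv,
      funext fun x ↦ (hd2 x).deriv]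
  have hpi : (π : ℂ) ≠ 0 := by exact_mod_cast pi_ne_zero
  rw [hgF, hdd] at h
  ext x
  have hx := congrFun h x
  have hpull : 𝓕 (fun x : ℝ ↦ (-2 * π * Complex.I * x) ^ 2 • g x) x =
      (-4 * π ^ 2) * 𝓕 (fun x : ℝ ↦ ((x ^ 2 * Real.exp (-π * x ^ 2) : ℝ) : ℂ)) x := by
    rw [Real.fourier_real_eq_integral_exp_smul, Real.fourier_real_eq_integral_exp_smul,
      ← integral_const_mul]
    congr with v
    simp only [smul_eq_mul, hg, mul_pow, Complex.I_sq]
    push_cast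
    ring
  rw [hpull] at hx
  have h4 : (-4 * π ^ 2 : ℂ) ≠ 0 := by simp [hpi]
  apply mul_left_cancel₀ h4
  rw [← hx, hg]
  push_cast
  field_simp
  ring

lemma integrable_pow_mul_gaussian_div_cosh (n : ℕ) :
    Integrable (fun x : ℝ ↦ x ^ n * Real.exp (-π * x ^ 2) / Real.cosh (π * x)) := by
  refine (integrable_pow_mul_gaussian n).mono
    (Continuous.div (by fun_prop) (by fun_prop) fun x ↦
      (Real.cosh_pos _).ne').aestronglyMeasurable (.of_forall fun x ↦ ?_)
  rw [norm_div]
  exact div_le_self (norm_nonneg _) ((one_le_cosh _).trans (le_abs_self _))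

lemma integral_sq_mul_gaussian_div_cosh :
    ∫ x : ℝ, x ^ 2 * Real.exp (-π * x ^ 2) / Real.cosh (π * x) =
      1 / (4 * π) * ∫ x : ℝ, Real.exp (-π * x ^ 2) / Real.cosh (π * x) := by
  have hint := (integrable_pow_mul_gaussian 2).ofReal (𝕜 := ℂ)
  have h := VectorFourier.integral_fourierIntegral_smul_eq_flip (L := innerₗ ℝ)
      Real.continuous_fourierChar continuous_inner hint integrable_one_div_cosh_pi_mul
  have h' : ∫ x : ℝ, 𝓕 (fun x : ℝ ↦ ((x ^ 2 * Real.exp (-π * x ^ 2) : ℝ) : ℂ)) x •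
        ((1 / Real.cosh (π * x) : ℝ) : ℂ) =
      ∫ x : ℝ, ((x ^ 2 * Real.exp (-π * x ^ 2) : ℝ) : ℂ) •
        𝓕 (fun x : ℝ ↦ ((1 / Real.cosh (π * x) : ℝ) : ℂ)) x := by
    simpa using! h
  rw [fourier_sq_mul_gaussian, fourier_one_div_cosh_pi_mul] at h'
  simp only [smul_eq_mul, ← Complex.ofReal_mul, integral_complex_ofReal] at h'
  have h0 : ∫ x : ℝ, (1 / (2 * π) - x ^ 2) * Real.exp (-π * x ^ 2) * (1 / Real.cosh (π * x)) =
      ∫ x : ℝ, x ^ 2 * Real.exp (-π * x ^ 2) * (1 / Real.cosh (π * x)) := by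
    exact_mod_cast h'
  have i0 := integrable_pow_mul_gaussian_div_cosh 0
  have i2 := integrable_pow_mul_gaussian_div_cosh 2
  simp only [pow_zero, one_mul] at i0
  have hs : ∫ x : ℝ, (1 / (2 * π) - x ^ 2) * Real.exp (-π * x ^ 2) * (1 / Real.cosh (π * x)) =
      1 / (2 * π) * (∫ x : ℝ, Real.exp (-π * x ^ 2) / Real.cosh (π * x)) -
      ∫ x : ℝ, x ^ 2 * Real.exp (-π * x ^ 2) / Real.cosh (π * x) := by
    rw [← integral_const_mul, ← integral_sub (i0.const_mul _) i2]
    congr with x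
    ring
  simp only [mul_one_div] at h0 hs
  rw [hs] at h0
  linear_combination (-1 / 2) * h0

lemma integral_Ioi_sq_mul_gaussian_div_cosh :
    ∫ x in Set.Ioi (0 : ℝ), x ^ 2 * Real.exp (-π * x ^ 2) / Real.cosh (π * x) =
      1 / (4 * π) * ∫ x in Set.Ioi (0 : ℝ), Real.exp (-π * x ^ 2) / Real.cosh (π * x) := by
  have hcosh (x : ℝ) : Real.cosh (π * |x|) = Real.cosh (π * x) := by
    rw [← Real.cosh_abs (π * x), abs_mul, abs_of_pos pi_pos]
  have h0 := integral_comp_abs (f := fun x ↦ Real.exp (-π * x ^ 2) / Real.cosh (π * x))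
  have h2 := integral_comp_abs (f := fun x ↦ x ^ 2 * Real.exp (-π * x ^ 2) / Real.cosh (π * x))
  simp only [sq_abs, hcosh] at h0 h2
  have h := integral_sq_mul_gaussian_div_cosh
  rw [h0, h2] at h
  linear_combination h / 2

lemma integrable_mul_gaussian_mul_sinh_div_cosh_sq :
    Integrable (fun x : ℝ ↦ x * Real.exp (-π * x ^ 2) *
      (Real.sinh (π * x) / Real.cosh (π * x) ^ 2)) := by
  refine (integrable_pow_mul_gaussian_div_cosh 1).mono
    (Continuous.mul (by fun_prop) (Continuous.div (by fun_prop) (by fun_prop) fun x ↦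
      pow_ne_zero 2 (Real.cosh_pos _).ne')).aestronglyMeasurable (.of_forall fun x ↦ ?_)
  have hc := Real.cosh_pos (π * x)
  have hs : |Real.sinh (π * x)| ≤ Real.cosh (π * x) :=
    abs_le_of_sq_le_sq (by linarith [Real.cosh_sq (π * x)]) hc.le
  rw [norm_mul, pow_one, norm_div _ (Real.cosh (π * x)), div_eq_mul_inv ‖_‖]
  gcongr
  rw [norm_div, norm_pow, Real.norm_eq_abs, Real.norm_of_nonneg hc.le, inv_eq_one_div,
    div_le_div_iff₀ (by positivity) hc]
  nlinarith

lemma integral_Ioi_mul_gaussian_mul_sinh_div_cosh_sq :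
    π * ∫ x in Set.Ioi (0 : ℝ), x * Real.exp (-π * x ^ 2) *
        (Real.sinh (π * x) / Real.cosh (π * x) ^ 2) =
      1 / 2 * ∫ x in Set.Ioi (0 : ℝ), Real.exp (-π * x ^ 2) / Real.cosh (π * x) := by
  have i0 := (integrable_pow_mul_gaussian_div_cosh 0).integrableOn (s := Set.Ioi 0)
  have i2 := (integrable_pow_mul_gaussian_div_cosh 2).integrableOn (s := Set.Ioi 0)
  have is := integrable_mul_gaussian_mul_sinh_div_cosh_sq.integrableOn (s := Set.Ioi 0)
  simp only [pow_zero, one_mul] at i0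
  have hderiv (x : ℝ) : HasDerivAt (fun x ↦ x * Real.exp (-π * x ^ 2) / Real.cosh (π * x))
      (Real.exp (-π * x ^ 2) / Real.cosh (π * x) -
        2 * π * (x ^ 2 * Real.exp (-π * x ^ 2) / Real.cosh (π * x)) -
        π * (x * Real.exp (-π * x ^ 2) * (Real.sinh (π * x) / Real.cosh (π * x) ^ 2))) x := by
    have hc : Real.cosh (π * x) ≠ 0 := (Real.cosh_pos _).ne'
    have he : HasDerivAt (fun x : ℝ ↦ Real.exp (-π * x ^ 2))
        (Real.exp (-π * x ^ 2) * (-π * (2 * x))) x := by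
      simpa using (((hasDerivAt_id x).pow 2).const_mul (-π)).exp
    have hcosh : HasDerivAt (fun x : ℝ ↦ Real.cosh (π * x)) (Real.sinh (π * x) * π) x := by
      simpa using ((hasDerivAt_id x).const_mul π).cosh
    refine (((hasDerivAt_id x).mul he).div hcosh hc).congr_deriv ?_
    simp only [id, Pi.mul_apply]
    field_simp
    ring
  have hint := (i0.sub (i2.const_mul (2 * π))).sub (is.const_mul π)
  have hF : IntegrableOn (fun x : ℝ ↦ x * Real.exp (-π * x ^ 2) / Real.cosh (π * x))
      (Set.Ioi 0) := by
    simpa using (integrable_pow_mul_gaussian_div_cosh 1).integrableOn (s := Set.Ioi 0)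
  have hlim := tendsto_zero_of_hasDerivAt_of_integrableOn_Ioi (fun x _ ↦ hderiv x) hint hF
  have h := integral_Ioi_of_hasDerivAt_of_tendsto' (a := 0) (fun x _ ↦ hderiv x) hint hlim
  have hsplit := integral_sub (i0.sub (i2.const_mul (2 * π))) (is.const_mul π)
  have hsplit' := integral_sub i0 (i2.const_mul (2 * π))
  simp only [Pi.sub_apply] at hsplit
  rw [hsplit, hsplit', integral_const_mul, integral_const_mul,
    integral_Ioi_sq_mul_gaussian_div_cosh] at h
  simp only [zero_mul, zero_div, sub_self] at h
  have hpi : 2 * π * (1 / (4 * π)) = 1 / 2 := by field_simp; norm_num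
  rw [← mul_assoc, hpi] at h
  linarith

theorem russell_integral_4 :
    ∫ x in Set.Ioi (0:ℝ),
      x * Real.exp (-x^2 / π) * (Real.sinh x / (Real.cosh x)^2) =
    ∫ x in Set.Ioi (0:ℝ), Real.exp (-4 * x^2 / π) / Real.cosh (2 * x) := by
  have hl := integral_comp_mul_left_Ioi' (fun x : ℝ ↦
    x * Real.exp (-x^2 / π) * (Real.sinh x / (Real.cosh x)^2)) 0 pi_pos
  have hr := integral_comp_mul_left_Ioi' (fun x : ℝ ↦
    Real.exp (-4 * x^2 / π) / Real.cosh (2 * x)) 0 (half_pos pi_pos)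
  have el (x : ℝ) : -(π * x) ^ 2 / π = -π * x ^ 2 := by field_simp
  have er (x : ℝ) : -4 * (π / 2 * x) ^ 2 / π = -π * x ^ 2 := by field_simp; ring
  have ec (x : ℝ) : 2 * (π / 2 * x) = π * x := by ring
  simp only [mul_zero, smul_eq_mul, el, er, ec] at hl hr
  rw [← hl, ← hr]
  simp only [mul_assoc π, integral_const_mul]
  rw [integral_Ioi_mul_gaussian_mul_sinh_div_cosh_sq]
  ring
end

section
/- ∫₀^∞ ( √π e^{-x²/3} + 9√3 π^{-2} e^{-3x²/π²} ) x²/cosh(x) dx = (3π√3/2) ∫₀^∞ e^{-3x²}/cosh(πx) dx. -/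
open Real MeasureTheory

open scoped FourierTransform Topology

lemma betaIntegrand_sigmoid (u : ℂ) (t : ℝ) :
    |sigmoid t * (1 - sigmoid t)| •
      ((sigmoid t : ℂ) ^ (u - 1) * (1 - (sigmoid t : ℂ)) ^ ((1 - u) - 1)) =
    Complex.exp ((u - 1 / 2) * t) / (2 * Real.cosh (t / 2) : ℝ) := by
  have hc : 0 < 2 * Real.cosh (t / 2) := by positivity
  have h0 : sigmoid t = Real.exp (t / 2 - Real.log (2 * Real.cosh (t / 2))) := by
    rw [Real.exp_sub, Real.exp_log hc, Real.sigmoid_def, Real.cosh_eq,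
      show -t = -(t / 2) + -(t / 2) by ring, Real.exp_add, Real.exp_neg]
    have := Real.exp_pos (t / 2)
    field_simp
  have h1 : 1 - sigmoid t = Real.exp (-(t / 2) - Real.log (2 * Real.cosh (t / 2))) := by
    rw [← Real.sigmoid_neg, Real.exp_sub, Real.exp_log hc, Real.sigmoid_def, Real.cosh_eq,
      show - -t = (t / 2) + (t / 2) by ring, Real.exp_add, Real.exp_neg]
    have := Real.exp_pos (t / 2)
    field_simp
    ring
  have h1' : (1 - (sigmoid t : ℂ)) = ((1 - sigmoid t : ℝ) : ℂ) := by push_cast; rfl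
  have hpow (r : ℝ) (z : ℂ) : ((Real.exp r : ℝ) : ℂ) ^ z = Complex.exp (r * z) := by
    rw [Complex.cpow_def_of_ne_zero (by exact_mod_cast (Real.exp_pos r).ne'),
      ← Complex.ofReal_log (Real.exp_pos r).le, Real.log_exp]
  rw [h1', h1, h0, abs_of_pos (by positivity), Complex.real_smul, hpow, hpow]
  conv_rhs => rw [← Real.exp_log hc]
  push_cast
  simp only [← Complex.exp_add, ← Complex.exp_sub]
  congr 1
  ring

lemma integrable_and_integral_exp_div_two_cosh {u : ℂ} (h0 : 0 < u.re) (h1 : u.re < 1) :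
    Integrable (fun t : ℝ => Complex.exp ((u - 1 / 2) * t) / (2 * Real.cosh (t / 2) : ℝ)) ∧
    ∫ t : ℝ, Complex.exp ((u - 1 / 2) * t) / (2 * Real.cosh (t / 2) : ℝ) =
      π / Complex.sin (π * u) := by
  have hderiv : ∀ t ∈ Set.univ,
      HasDerivWithinAt sigmoid (sigmoid t * (1 - sigmoid t)) Set.univ t :=
    fun t _ => (hasDerivAt_sigmoid t).hasDerivWithinAt
  have himage : sigmoid '' Set.univ = Set.Ioo 0 1 := by rw [Set.image_univ, range_sigmoid]
  have hre : 0 < (1 - u).re := by simpa using h1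
  have hInt := Complex.betaIntegral_convergent h0 hre
  have hval := Complex.betaIntegral_eq_Gamma_mul_div u (1 - u) h0 hre
  rw [intervalIntegrable_iff_integrableOn_Ioo_of_le zero_le_one, ← himage,
    integrableOn_image_iff_integrableOn_abs_deriv_smul MeasurableSet.univ hderiv
      sigmoid_injective.injOn] at hInt
  rw [add_sub_cancel, Complex.Gamma_one, div_one, Complex.Gamma_mul_Gamma_one_sub,
    Complex.betaIntegral, intervalIntegral.integral_of_le zero_le_one,
    integral_Ioc_eq_integral_Ioo, ← himage,
    integral_image_eq_integral_abs_deriv_smul MeasurableSet.univ hderiv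
      sigmoid_injective.injOn] at hval
  simp only [betaIntegrand_sigmoid, integrableOn_univ, setIntegral_univ] at hInt hval
  exact ⟨hInt, hval⟩

lemma integrable_inv_cosh_pi_mul :
    Integrable (fun x : ℝ => (((Real.cosh (π * x))⁻¹ : ℝ) : ℂ)) := by
  have h := (integrable_and_integral_exp_div_two_cosh (u := 1 / 2) (by norm_num)
    (by norm_num)).1.comp_mul_left' (R := 2 * π) (by positivity)
  convert h.const_mul 2 using 2 with x
  rw [show 2 * π * x / 2 = π * x by ring]
  have := (Real.cosh_pos (π * x)).ne'
  simp
  field_simp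

lemma fourier_inv_cosh_pi_mul :
    𝓕 (fun x : ℝ => (((Real.cosh (π * x))⁻¹ : ℝ) : ℂ)) =
      fun x : ℝ => (((Real.cosh (π * x))⁻¹ : ℝ) : ℂ) := by
  ext w
  have hre : (1 / 2 - w * Complex.I : ℂ).re = 1 / 2 := by simp
  have h := (integrable_and_integral_exp_div_two_cosh (u := 1 / 2 - w * Complex.I)
    (by rw [hre]; norm_num) (by rw [hre]; norm_num)).2
  have hs := Measure.integral_comp_mul_left (fun t : ℝ =>
    Complex.exp ((1 / 2 - w * Complex.I - 1 / 2) * t) / (2 * Real.cosh (t / 2) : ℝ)) (2 * π)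
  rw [h] at hs
  have hsin : Complex.sin (π * (1 / 2 - w * Complex.I)) = (Real.cosh (π * w) : ℝ) := by
    rw [show (π * (1 / 2 - w * Complex.I) : ℂ) = π / 2 - (π * w) * Complex.I by ring,
      Complex.sin_pi_div_two_sub, Complex.cos_mul_I]
    push_cast
    rfl
  rw [hsin, abs_of_pos (by positivity)] at hs
  rw [fourier_real_eq_integral_exp_smul]
  have hcongr : ∀ v : ℝ, Complex.exp (↑(-2 * π * v * w) * Complex.I) •
      (((Real.cosh (π * v))⁻¹ : ℝ) : ℂ) =
      2 * (Complex.exp ((1 / 2 - w * Complex.I - 1 / 2) * (2 * π * v : ℝ)) /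
        (2 * Real.cosh (2 * π * v / 2) : ℝ)) := by
    intro v
    rw [show 2 * π * v / 2 = π * v by ring, smul_eq_mul,
      show (↑(-2 * π * v * w) * Complex.I : ℂ) =
        (1 / 2 - w * Complex.I - 1 / 2) * (2 * π * v : ℝ) by push_cast; ring]
    push_cast
    ring
  simp_rw [hcongr]
  rw [integral_const_mul, hs, Complex.real_smul]
  have : (π : ℂ) ≠ 0 := by exact_mod_cast pi_ne_zero
  push_cast
  field_simp

/-- The moment of order `2 * n` over the real line of `exp (-a * x ^ 2) / cosh (π * x)`. -/
noncomputable def gaussianSechMoment (n : ℕ) (a : ℝ) : ℝ :=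
  ∫ x : ℝ, x ^ (2 * n) * Real.exp (-a * x ^ 2) / Real.cosh (π * x)

lemma gaussianSechMoment_zero_eq {a : ℝ} (ha : 0 < a) :
    gaussianSechMoment 0 a = √(π / a) * gaussianSechMoment 0 (π ^ 2 / a) := by
  have hb : 0 < a / π := by positivity
  have hgauss : Integrable (fun x : ℝ => Complex.exp (-π * (a / π : ℝ) * x ^ 2)) := by
    have := integrable_cexp_neg_mul_sq (b := (a : ℂ)) (by simpa using ha)
    convert this using 4 with x
    push_cast
    have : (π : ℂ) ≠ 0 := by exact_mod_cast pi_ne_zero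
    field_simp
  have h := VectorFourier.integral_fourierIntegral_smul_eq_flip (L := innerₗ ℝ)
    (μ := volume) (ν := volume) continuous_fourierChar continuous_inner hgauss
    integrable_inv_cosh_pi_mul
  rw [flip_innerₗ] at h
  change ∫ ξ, (𝓕 (fun x : ℝ => Complex.exp (-π * (a / π : ℝ) * x ^ 2))) ξ • _ =
    ∫ x, _ • (𝓕 (fun x : ℝ => (((Real.cosh (π * x))⁻¹ : ℝ) : ℂ))) x at h
  rw [fourier_inv_cosh_pi_mul, fourier_gaussian_pi (by simpa using hb)] at h
  have hl (x : ℝ) : (1 / ((a / π : ℝ) : ℂ) ^ (1 / 2 : ℂ) *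
      Complex.exp (-π / (a / π : ℝ) * x ^ 2)) • (((Real.cosh (π * x))⁻¹ : ℝ) : ℂ) =
      ((√(π / a) *
        (x ^ (2 * 0) * Real.exp (-(π ^ 2 / a) * x ^ 2) / Real.cosh (π * x)) : ℝ) : ℂ) := by
    have : ((a / π : ℝ) : ℂ) ^ (1 / 2 : ℂ) = ((√(a / π) : ℝ) : ℂ) := by
      rw [Real.sqrt_eq_rpow, Complex.ofReal_cpow hb.le]
      norm_num
    rw [this, ← inv_div a π, Real.sqrt_inv, smul_eq_mul,
      show -(π ^ 2 / a) * x ^ 2 = -π / (a / π) * x ^ 2 by field_simp]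
    push_cast
    ring
  have hr (x : ℝ) : Complex.exp (-π * (a / π : ℝ) * x ^ 2) •
      (((Real.cosh (π * x))⁻¹ : ℝ) : ℂ) =
      ((x ^ (2 * 0) * Real.exp (-a * x ^ 2) / Real.cosh (π * x) : ℝ) : ℂ) := by
    rw [smul_eq_mul, show -a * x ^ 2 = -π * (a / π) * x ^ 2 by field_simp]
    push_cast
    ring
  simp_rw [hl, hr] at h
  rw [integral_complex_ofReal, integral_complex_ofReal, integral_const_mul] at h
  exact_mod_cast h.symm

lemma integrable_pow_mul_exp_neg_mul_sq (n : ℕ) {a : ℝ} (ha : 0 < a) :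
    Integrable (fun x : ℝ => x ^ n * Real.exp (-a * x ^ 2)) := by
  simpa only [Real.rpow_natCast] using integrable_rpow_mul_exp_neg_mul_sq ha (s := n)
    (neg_one_lt_zero.trans_le n.cast_nonneg)

lemma continuous_pow_mul_exp_neg_mul_sq_div_cosh (n : ℕ) (a : ℝ) :
    Continuous (fun x : ℝ => x ^ n * Real.exp (-a * x ^ 2) / Real.cosh (π * x)) :=
  Continuous.div (by fun_prop) (by fun_prop) fun x => (Real.cosh_pos _).ne'

lemma norm_pow_mul_exp_neg_mul_sq_div_cosh_le (n : ℕ) {a b : ℝ} (hab : b ≤ a) (x : ℝ) :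
    ‖x ^ (2 * n) * Real.exp (-a * x ^ 2) / Real.cosh (π * x)‖ ≤
      x ^ (2 * n) * Real.exp (-b * x ^ 2) := by
  have hx : 0 ≤ x ^ (2 * n) := (even_two_mul n).pow_nonneg x
  rw [Real.norm_of_nonneg (by positivity)]
  refine (div_le_self (by positivity) (Real.one_le_cosh _)).trans ?_
  gcongr

lemma integrable_pow_mul_exp_neg_mul_sq_div_cosh (n : ℕ) {a : ℝ} (ha : 0 < a) :
    Integrable (fun x : ℝ => x ^ (2 * n) * Real.exp (-a * x ^ 2) / Real.cosh (π * x)) :=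
  (integrable_pow_mul_exp_neg_mul_sq (2 * n) ha).mono'
    (continuous_pow_mul_exp_neg_mul_sq_div_cosh _ _).aestronglyMeasurable
    (ae_of_all _ (norm_pow_mul_exp_neg_mul_sq_div_cosh_le n le_rfl))

lemma hasDerivAt_gaussianSechMoment (n : ℕ) {a : ℝ} (ha : 0 < a) :
    HasDerivAt (gaussianSechMoment n) (-gaussianSechMoment (n + 1) a) a := by
  have h := (hasDerivAt_integral_of_dominated_loc_of_deriv_le (μ := volume)
    (F := fun a x : ℝ => x ^ (2 * n) * Real.exp (-a * x ^ 2) / Real.cosh (π * x))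
    (F' := fun a x : ℝ => -(x ^ (2 * (n + 1)) * Real.exp (-a * x ^ 2) / Real.cosh (π * x)))
    (Ioi_mem_nhds (half_lt_self ha))
    (Filter.Eventually.of_forall fun b =>
      (continuous_pow_mul_exp_neg_mul_sq_div_cosh _ b).aestronglyMeasurable)
    (integrable_pow_mul_exp_neg_mul_sq_div_cosh n ha)
    (continuous_pow_mul_exp_neg_mul_sq_div_cosh _ a).neg.aestronglyMeasurable
    (ae_of_all _ fun x b hb => by
      rw [norm_neg]
      exact norm_pow_mul_exp_neg_mul_sq_div_cosh_le (n + 1) (Set.mem_Ioi.mp hb).le x)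
    (integrable_pow_mul_exp_neg_mul_sq (2 * (n + 1)) (half_pos ha))
    (ae_of_all _ fun x b _ => by
      have h := ((((hasDerivAt_id b).neg.mul_const (x ^ 2)).exp).const_mul
        (x ^ (2 * n))).div_const (Real.cosh (π * x))
      refine h.congr_deriv ?_
      simp only [Pi.neg_apply, id]
      ring)).2
  rwa [integral_neg] at h

lemma gaussianSechMoment_one_eq {a : ℝ} (ha : 0 < a) :
    gaussianSechMoment 1 a = gaussianSechMoment 0 a / (2 * a) -
      √(π / a) * (π ^ 2 / a ^ 2) * gaussianSechMoment 1 (π ^ 2 / a) := by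
  have hquot (c : ℝ) : HasDerivAt (fun x : ℝ => c / x) (-c / a ^ 2) a :=
    ((hasDerivAt_const a c).div (hasDerivAt_id a) ha.ne').congr_deriv (by simp)
  have hprod := ((hquot π).sqrt (by positivity)).mul
    ((hasDerivAt_gaussianSechMoment 0 (by positivity : 0 < π ^ 2 / a)).comp a (hquot (π ^ 2)))
  have hev : gaussianSechMoment 0 =ᶠ[𝓝 a]
      (fun x => √(π / x)) * (gaussianSechMoment 0 ∘ fun x => π ^ 2 / x) := by
    filter_upwards [Ioi_mem_nhds ha] with x hx using gaussianSechMoment_zero_eq hx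
  have h := (hasDerivAt_gaussianSechMoment 0 ha).unique (hprod.congr_of_eventuallyEq hev)
  have hsq : √(π / a) ^ 2 = π / a := Real.sq_sqrt (by positivity)
  have hpos : 0 < √(π / a) := by positivity
  have hcoef : -π / a ^ 2 / (2 * √(π / a)) = -√(π / a) / (2 * a) := by
    rw [show -π / a ^ 2 = -(π / a) / a by field_simp]
    nth_rewrite 1 [← hsq]
    field_simp
  rw [hcoef] at h
  rw [gaussianSechMoment_zero_eq ha]
  simp only [Function.comp_apply, zero_add] at h
  linear_combination -h

lemma integral_Ioi_eq_gaussianSechMoment (n : ℕ) (a : ℝ) :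
    ∫ x in Set.Ioi (0 : ℝ), x ^ (2 * n) * Real.exp (-a * x ^ 2) / Real.cosh (π * x) =
      gaussianSechMoment n a / 2 := by
  have h := integral_comp_abs
    (f := fun x : ℝ => x ^ (2 * n) * Real.exp (-a * x ^ 2) / Real.cosh (π * x))
  have habs (x : ℝ) : Real.cosh (π * |x|) = Real.cosh (π * x) := by
    rw [← Real.cosh_abs (π * x), abs_mul, abs_of_pos pi_pos]
  simp only [sq_abs, (even_two_mul n).pow_abs, habs] at h
  rw [gaussianSechMoment, h]
  ring

theorem russell_integral_8 :
    ∫ x in Set.Ioi (0:ℝ),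
      (Real.sqrt π * Real.exp (-x^2 / 3) +
        9 * Real.sqrt 3 * π^(-2 : ℤ) * Real.exp (-3 * x^2 / π^2)) * (x^2 / Real.cosh x) =
    (3 * π * Real.sqrt 3 / 2) * ∫ x in Set.Ioi (0:ℝ), Real.exp (-3 * x^2) / Real.cosh (π * x) := by
  have hF := integral_Ioi_eq_gaussianSechMoment 0 3
  have hscale := integral_comp_mul_left_Ioi' (fun x : ℝ =>
    (Real.sqrt π * Real.exp (-x^2 / 3) +
      9 * Real.sqrt 3 * π^(-2 : ℤ) * Real.exp (-3 * x^2 / π^2)) * (x^2 / Real.cosh x)) 0 pi_pos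
  have hpt (x : ℝ) : (Real.sqrt π * Real.exp (-(π * x)^2 / 3) +
      9 * Real.sqrt 3 * π^(-2 : ℤ) * Real.exp (-3 * (π * x)^2 / π^2)) *
        ((π * x)^2 / Real.cosh (π * x)) =
      √π * π ^ 2 * (x ^ (2 * 1) * Real.exp (-(π ^ 2 / 3) * x ^ 2) / Real.cosh (π * x)) +
      9 * √3 * (x ^ (2 * 1) * Real.exp (-3 * x ^ 2) / Real.cosh (π * x)) := by
    rw [show -(π * x) ^ 2 / 3 = -(π ^ 2 / 3) * x ^ 2 by ring,
      show -3 * (π * x) ^ 2 / π ^ 2 = -3 * x ^ 2 by field_simp, zpow_neg]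
    have := (Real.cosh_pos (π * x)).ne'
    have := pi_ne_zero
    norm_cast
    field_simp
  have hInt (a : ℝ) (ha : 0 < a) := (integrable_pow_mul_exp_neg_mul_sq_div_cosh 1 ha).integrableOn
    (s := Set.Ioi 0)
  simp only [hpt, mul_zero] at hscale
  rw [integral_add ((hInt _ (by positivity)).const_mul _) ((hInt _ (by norm_num)).const_mul _),
    integral_const_mul, integral_const_mul, integral_Ioi_eq_gaussianSechMoment,
    integral_Ioi_eq_gaussianSechMoment, gaussianSechMoment_one_eq (a := 3) (by norm_num),
    Real.sqrt_div pi_pos.le, smul_eq_mul] at hscale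
  simp only [mul_zero, pow_zero, one_mul] at hF
  rw [← hscale, hF]
  field_simp
  ring
end
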